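/- arXiv:2408.12291 — 7 statements merged into one kernel-verified Lean document; each statement's English description precedes it below -/
import Mathlib

section
/- Let F be the free group on two generators a and b. Let r be an odd positive integer and s an even integer with s ≥ 2. Then there is no element x ∈ F satisfying both ⟨a,x⟩_r = ⟨x,a⟩_r and ⟨b,x⟩_s = ⟨x,b⟩_s. -/
/-- `altProd u v m` is the alternating product `u * v * u * v * ⋯` with `m` factors. -/
def altProd {G : Type*} [Monoid G] : G → G → ℕ → G
  | _, _, 0 => 1
  | u, v, n + 1 => u * altProd v u n

theorem altProd_two_mul {G : Type*} [Monoid G] (u v : G) (k : ℕ) :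
    altProd u v (2 * k) = (u * v) ^ k := by
  induction k with
  | zero => simp [altProd]
  | succ k ih =>
    change u * (v * altProd u v (2 * k)) = _
    rw [ih, pow_succ', mul_assoc]

theorem altProd_two_mul_add_one {G : Type*} [Monoid G] (u v : G) (k : ℕ) :
    altProd u v (2 * k + 1) = u * (v * u) ^ k := by
  rw [← altProd_two_mul]
  rfl

/-- The homomorphism `F → ℚˣ` sending `a` to `2` and `b` to `1`. -/
def affineSlope : FreeGroup (Fin 2) →* ℚˣ :=
  FreeGroup.lift ![Units.mk0 2 two_ne_zero, 1]

/-- The action of `F` on `ℚ` by affine maps in which `a` doubles and `b` translates by `1`. -/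
def affineAction : FreeGroup (Fin 2) →* Equiv.Perm ℚ :=
  FreeGroup.lift ![Equiv.mulLeft₀ 2 two_ne_zero, Equiv.addRight 1]

theorem affineAction_sub (w : FreeGroup (Fin 2)) (p q : ℚ) :
    affineAction w p - affineAction w q = affineSlope w * (p - q) := by
  induction w using FreeGroup.induction_on generalizing p q with
  | C1 => simp
  | of i => fin_cases i <;> simp [affineAction, affineSlope, mul_sub]
  | inv_of i _ => fin_cases i <;> simp [affineAction, affineSlope, mul_sub]
  | mul x y hx hy => simp [hx, hy, mul_assoc]

theorem affineSlope_eq_one_of_commute {w : FreeGroup (Fin 2)} (h : Commute w (FreeGroup.of 1)) :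
    affineSlope w = 1 := by
  have h1 := affineAction_sub w 1 0
  have h2 := congrArg (fun g => affineAction g 0) h.eq
  have h3 (q : ℚ) : affineAction (FreeGroup.of 1) q = q + 1 := by simp [affineAction]
  simp only [map_mul, Equiv.Perm.mul_apply, h3, zero_add] at h2
  rw [h2] at h1
  ext
  simpa using h1.symm

/-- In the free group on two generators `a`, `b`, for `r` odd and positive and `s`
even with `s ≥ 2`, the system of equations `⟨a,x⟩_r = ⟨x,a⟩_r`, `⟨b,x⟩_s = ⟨x,b⟩_s`
has no solution `x`. -/
theorem no_solution_free_group (r s : ℕ) (hr : Odd r) (hrpos : 0 < r)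
    (hs : Even s) (hs2 : 2 ≤ s) :
    ¬ ∃ x : FreeGroup (Fin 2),
        altProd (FreeGroup.of 0) x r = altProd x (FreeGroup.of 0) r ∧
        altProd (FreeGroup.of 1) x s = altProd x (FreeGroup.of 1) s := by
  rintro ⟨x, ha, hb⟩
  obtain ⟨k, rfl⟩ := hr
  obtain ⟨m, rfl⟩ := even_iff_exists_two_mul.mp hs
  rw [altProd_two_mul_add_one, altProd_two_mul_add_one] at ha
  rw [altProd_two_mul, altProd_two_mul] at hb
  have hx : affineSlope x = Units.mk0 2 two_ne_zero := by
    have h := congrArg affineSlope ha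
    rw [map_mul, map_mul, map_pow, map_pow, map_mul, map_mul, mul_comm (affineSlope x) (affineSlope _),
      mul_left_inj] at h
    simpa [affineSlope] using h.symm
  have hcomm : Commute ((FreeGroup.of 1 * x) ^ m) (FreeGroup.of 1) := by
    have h : SemiconjBy (FreeGroup.of 1) (x * FreeGroup.of 1) (FreeGroup.of 1 * x) :=
      (mul_assoc _ _ _).symm
    have h' := h.pow_right m
    rw [← hb] at h'
    exact h'.symm
  have h := affineSlope_eq_one_of_commute hcomm
  have h1 : affineSlope (FreeGroup.of 1) = 1 := affineSlope_eq_one_of_commute (Commute.refl _)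
  rw [map_pow, map_mul, h1, one_mul, hx] at h
  have h2 : (2 : ℚ) ^ m = 1 := by simpa using congrArg Units.val h
  exact (one_lt_pow₀ (one_lt_two : (1 : ℚ) < 2) (by omega)).ne' h2
end

section
/- Suppose that for all pairwise distinct a, b, c ∈ S the triple of labels (M a b, M b c, M a c) satisfies the triangle condition: at least two of the three labels equal 2, or at least two of them equal ∞, or exactly one of them equals ∞ and the other two are even and finite (equivalently, every triangle is of the form (2,2,k), (2m,2n,∞), or (k,∞,∞)). Then for every X ⊆ S there exists a group homomorphism ρ_X : A_M → A_M such that: ρ_X(s) = s for every s ∈ X; ρ_X(v) = a for every v ∉ X and a ∈ X with M v a odd and finite; and ρ_X(v) = 1 for every v ∉ X such that M v a is even or ∞ for all a ∈ X. In particular, ρ_X is a retraction of A_M onto the standard parabolic subgroup A_X. -/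
/-- The relation set of the Artin group of the labelled Coxeter matrix `M`
(label `⊤` meaning no relation). -/
def ArtinRels {S : Type*} (M : S → S → ℕ∞) : Set (FreeGroup S) :=
  { r | ∃ (s t : S) (m : ℕ), s ≠ t ∧ M s t = (m : ℕ∞) ∧
        r = altProd (FreeGroup.of s) (FreeGroup.of t) m *
            (altProd (FreeGroup.of t) (FreeGroup.of s) m)⁻¹ }

/-- The Artin group of the labelled Coxeter matrix `M`. -/
abbrev ArtinGroup {S : Type*} (M : S → S → ℕ∞) :=
  PresentedGroup (ArtinRels M)

/-- The image in the Artin group of the generator `s`. -/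
def agen {S : Type*} (M : S → S → ℕ∞) (s : S) : ArtinGroup M :=
  PresentedGroup.of s

/-- The standard parabolic subgroup of the Artin group generated by `X ⊆ S`. -/
def parabolic {S : Type*} (M : S → S → ℕ∞) (X : Set S) : Subgroup (ArtinGroup M) :=
  Subgroup.closure (agen M '' X)

/-- The conjugate `g H g⁻¹` of a subgroup `H`. -/
def conjSub {G : Type*} [Group G] (g : G) (H : Subgroup G) : Subgroup G :=
  H.map (MulAut.conj g).toMonoidHom

/-- `ρ` is a retraction of `G` onto its subgroup `H`: its image is contained in `H`
and it fixes every element of `H`. -/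
def IsRetraction {G : Type*} [Group G] (ρ : G →* G) (H : Subgroup G) : Prop :=
  (∀ g, ρ g ∈ H) ∧ ∀ h ∈ H, ρ h = h

/-- The extended natural number `x` is finite and odd. -/
def OddLab (x : ℕ∞) : Prop := ∃ m : ℕ, x = (m : ℕ∞) ∧ Odd m

/-- The extended natural number `x` is finite and even. -/
def EvenFin (x : ℕ∞) : Prop := ∃ m : ℕ, x = (m : ℕ∞) ∧ Even m

/-- The extended natural number `x` is even or equal to `∞`. -/
def EvenOrInf (x : ℕ∞) : Prop := ∀ m : ℕ, x = (m : ℕ∞) → Even m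

/-- The triangle condition on a triple of labels: at least two of them equal `2`,
or at least two of them equal `∞`, or exactly one of them equals `∞` and the
other two are even and finite; i.e. the triangle is of the form `(2,2,k)`,
`(2m,2n,∞)` or `(k,∞,∞)`. -/
def TriangleCond (p q r : ℕ∞) : Prop :=
  ((p = 2 ∧ q = 2) ∨ (p = 2 ∧ r = 2) ∨ (q = 2 ∧ r = 2)) ∨
  ((p = ⊤ ∧ q = ⊤) ∨ (p = ⊤ ∧ r = ⊤) ∨ (q = ⊤ ∧ r = ⊤)) ∨
  ((p = ⊤ ∧ EvenFin q ∧ EvenFin r) ∨ (q = ⊤ ∧ EvenFin p ∧ EvenFin r) ∨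
   (r = ⊤ ∧ EvenFin p ∧ EvenFin q))

theorem map_altProd {G H : Type*} [Monoid G] [Monoid H] (φ : G →* H) (u v : G) (m : ℕ) :
    φ (altProd u v m) = altProd (φ u) (φ v) m := by
  induction m generalizing u v with
  | zero => simp [altProd]
  | succ n ih => simp [altProd, ih]

theorem altProd_one_comm_of_even {G : Type*} [Monoid G] (u : G) {m : ℕ} (hm : Even m) :
    altProd u 1 m = altProd 1 u m := by
  obtain ⟨k, rfl⟩ := hm.exists_two_nsmul
  induction k with
  | zero => rfl
  | succ k ih =>
    have ih := ih (even_two_mul k)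
    simp only [smul_eq_mul, mul_add, mul_one, altProd, one_mul] at ih ⊢
    rw [ih]

/-- The defining relation of the Artin group between two generators with a finite label. -/
theorem altProd_agen {S : Type*} (M : S → S → ℕ∞) {s t : S} {m : ℕ} (hst : s ≠ t)
    (hm : M s t = m) :
    altProd (agen M s) (agen M t) m = altProd (agen M t) (agen M s) m := by
  have h : PresentedGroup.mk (ArtinRels M) _ = 1 :=
    PresentedGroup.one_of_mem ⟨s, t, m, hst, hm, rfl⟩
  rw [map_mul, map_inv, mul_inv_eq_one, map_altProd, map_altProd] at h
  exact h

theorem OddLab.ne_two {x : ℕ∞} (h : OddLab x) : x ≠ 2 := by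
  obtain ⟨m, rfl, hm⟩ := h
  intro h2
  have : m = 2 := by exact_mod_cast h2
  subst this
  exact absurd hm (by decide)

theorem OddLab.ne_top {x : ℕ∞} (h : OddLab x) : x ≠ ⊤ := by
  obtain ⟨m, rfl, -⟩ := h
  exact ENat.natCast_ne_top m

theorem OddLab.not_evenFin {x : ℕ∞} (h : OddLab x) : ¬ EvenFin x := by
  obtain ⟨m, rfl, hm⟩ := h
  rintro ⟨n, hn, hn'⟩
  have : m = n := by exact_mod_cast hn
  subst this
  exact Nat.not_even_iff_odd.mpr hm hn'

/-- In a triangle satisfying the condition, the two edges adjacent to an odd edge have the same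
label, which is `2` or `∞`. -/
theorem TriangleCond.of_oddLab {p q r : ℕ∞} (h : TriangleCond p q r) (hp : OddLab p) :
    q = r ∧ ¬ OddLab q := by
  have h2 := hp.ne_two
  have ht := hp.ne_top
  have he := hp.not_evenFin
  have h2' : ¬ OddLab 2 := fun h => h.ne_two rfl
  have ht' : ¬ OddLab ⊤ := fun h => h.ne_top rfl
  rcases h with (⟨a, b⟩ | ⟨a, b⟩ | ⟨a, b⟩) | (⟨a, b⟩ | ⟨a, b⟩ | ⟨a, b⟩) |
    (⟨a, b, c⟩ | ⟨a, b, c⟩ | ⟨a, b, c⟩) <;> subst_vars <;> first | contradiction | simp_all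

/-- `a` is the element of `X` to which the ordinary retraction sends the generator `s`. -/
def IsOddNeighbour {S : Type*} (M : S → S → ℕ∞) (X : Set S) (s a : S) : Prop :=
  a ∈ X ∧ (s = a ∨ s ∉ X ∧ OddLab (M s a))

open Classical in
/-- The values of the ordinary retraction onto `A_X` on the generators. -/
noncomputable def ordinaryRetractionFun {S : Type*} (M : S → S → ℕ∞) (X : Set S) (s : S) :
    ArtinGroup M :=
  if h : ∃ a, IsOddNeighbour M X s a then agen M h.choose else 1

section

variable {S : Type*} {M : S → S → ℕ∞} {X : Set S} {s t a b : S}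

theorem ordinaryRetractionFun_of_not_exists (h : ¬ ∃ a, IsOddNeighbour M X s a) :
    ordinaryRetractionFun M X s = 1 :=
  dif_neg h

theorem ordinaryRetractionFun_mem_parabolic (M : S → S → ℕ∞) (X : Set S) (s : S) :
    ordinaryRetractionFun M X s ∈ parabolic M X := by
  unfold ordinaryRetractionFun
  split_ifs with h
  · exact Subgroup.subset_closure ⟨_, h.choose_spec.1, rfl⟩
  · exact one_mem _

theorem not_oddLab_of_isOddNeighbour_of_not_exists
    (hsymm : ∀ s t, M s t = M t s)
    (htri : ∀ a b c : S, a ≠ b → b ≠ c → a ≠ c → TriangleCond (M a b) (M b c) (M a c))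
    (hst : s ≠ t) (ha : IsOddNeighbour M X s a) (ht : ¬ ∃ b, IsOddNeighbour M X t b) :
    ¬ OddLab (M s t) := by
  intro ho
  have htX : t ∉ X := fun h => ht ⟨t, h, .inl rfl⟩
  obtain ⟨haX, rfl | ⟨hs, hodd⟩⟩ := ha
  · exact ht ⟨s, haX, .inr ⟨htX, hsymm s t ▸ ho⟩⟩
  · have hsa : s ≠ a := fun h => hs (h ▸ haX)
    have hat : a ≠ t := fun h => htX (h ▸ haX)
    obtain ⟨h1, h2⟩ := (htri s a t hsa hat hst).of_oddLab hodd
    exact h2 (h1 ▸ ho)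

theorem IsOddNeighbour.unique
    (hsymm : ∀ s t, M s t = M t s)
    (htri : ∀ a b c : S, a ≠ b → b ≠ c → a ≠ c → TriangleCond (M a b) (M b c) (M a c))
    (ha : IsOddNeighbour M X s a) (hb : IsOddNeighbour M X s b) : a = b := by
  obtain ⟨haX, rfl | ⟨hs, ha⟩⟩ := ha
  · obtain ⟨-, h | ⟨h, -⟩⟩ := hb
    exacts [h, absurd haX h]
  · obtain ⟨hbX, rfl | ⟨-, hb⟩⟩ := hb
    · exact absurd hbX hs
    by_contra hab
    have hsa : a ≠ s := fun h => hs (h ▸ haX)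
    have hsb : s ≠ b := fun h => hs (h ▸ hbX)
    exact ((htri a s b hsa hsb hab).of_oddLab (hsymm s a ▸ ha)).2 hb

theorem IsOddNeighbour.label_eq
    (htri : ∀ a b c : S, a ≠ b → b ≠ c → a ≠ c → TriangleCond (M a b) (M b c) (M a c))
    (ha : IsOddNeighbour M X s a) (hst : s ≠ t) (hat : a ≠ t) : M s t = M a t := by
  obtain ⟨haX, rfl | ⟨hs, ha⟩⟩ := ha
  · rfl
  · exact ((htri s a t (fun h => hs (h ▸ haX)) hat hst).of_oddLab ha).1.symm

theorem ordinaryRetractionFun_eq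
    (hsymm : ∀ s t, M s t = M t s)
    (htri : ∀ a b c : S, a ≠ b → b ≠ c → a ≠ c → TriangleCond (M a b) (M b c) (M a c))
    (ha : IsOddNeighbour M X s a) : ordinaryRetractionFun M X s = agen M a := by
  have h : ∃ a, IsOddNeighbour M X s a := ⟨a, ha⟩
  rw [ordinaryRetractionFun, dif_pos h, h.choose_spec.unique hsymm htri ha]

theorem altProd_ordinaryRetractionFun
    (hsymm : ∀ s t, M s t = M t s)
    (htri : ∀ a b c : S, a ≠ b → b ≠ c → a ≠ c → TriangleCond (M a b) (M b c) (M a c))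
    {m : ℕ} (hst : s ≠ t) (hm : M s t = m) :
    altProd (ordinaryRetractionFun M X s) (ordinaryRetractionFun M X t) m =
      altProd (ordinaryRetractionFun M X t) (ordinaryRetractionFun M X s) m := by
  by_cases hs : ∃ a, IsOddNeighbour M X s a <;> by_cases ht : ∃ b, IsOddNeighbour M X t b
  · obtain ⟨a, ha⟩ := hs
    obtain ⟨b, hb⟩ := ht
    rw [ordinaryRetractionFun_eq hsymm htri ha, ordinaryRetractionFun_eq hsymm htri hb]
    rcases eq_or_ne a b with rfl | hab
    · rfl
    have hat : a ≠ t := fun h => hab (IsOddNeighbour.unique hsymm htri ⟨ha.1, .inl h.symm⟩ hb)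
    refine altProd_agen M hab ?_
    rw [← hm, ha.label_eq htri hst hat, hsymm a t, hb.label_eq htri hat.symm hab.symm, hsymm]
  · obtain ⟨a, ha⟩ := hs
    rw [ordinaryRetractionFun_of_not_exists ht]
    refine altProd_one_comm_of_even _ (Nat.not_odd_iff_even.mp fun h => ?_)
    exact not_oddLab_of_isOddNeighbour_of_not_exists hsymm htri hst ha ht ⟨m, hm, h⟩
  · obtain ⟨b, hb⟩ := ht
    rw [ordinaryRetractionFun_of_not_exists hs]
    refine (altProd_one_comm_of_even _ (Nat.not_odd_iff_even.mp fun h => ?_)).symm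
    exact not_oddLab_of_isOddNeighbour_of_not_exists hsymm htri hst.symm hb hs
      ⟨m, hsymm s t ▸ hm, h⟩
  · rw [ordinaryRetractionFun_of_not_exists hs, ordinaryRetractionFun_of_not_exists ht]

theorem isRetraction_parabolic {ρ : ArtinGroup M →* ArtinGroup M}
    (hmem : ∀ s, ρ (agen M s) ∈ parabolic M X) (hfix : ∀ s ∈ X, ρ (agen M s) = agen M s) :
    IsRetraction ρ (parabolic M X) := by
  refine ⟨fun g => ?_, fun h hh => ?_⟩
  · induction g using PresentedGroup.induction_on with | _ g
    induction g using FreeGroup.induction_on with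
    | C1 => simp
    | of s => exact hmem s
    | inv_of s _ => rw [map_inv, map_inv]; exact inv_mem (hmem s)
    | mul x y hx hy => rw [map_mul, map_mul]; exact mul_mem hx hy
  · have hle : parabolic M X ≤ MonoidHom.eqLocus ρ (MonoidHom.id _) := by
      rw [parabolic, Subgroup.closure_le]
      rintro _ ⟨s, hs, rfl⟩
      exact hfix s hs
    exact hle hh

end

/-- If every triangle of the Coxeter graph of `M` is of the form `(2,2,k)`,
`(2m,2n,∞)` or `(k,∞,∞)`, then for every `X ⊆ S` the Artin group of `M` admits the
ordinary retraction onto the standard parabolic subgroup `A_X`: it fixes the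
generators in `X`, sends a generator `v ∉ X` joined to some `a ∈ X` by an odd
label to `a`, and sends the remaining generators to `1`. -/
theorem triangle_cond_admits_ordinary_retractions {S : Type*} [Fintype S]
    (M : S → S → ℕ∞)
    (hsymm : ∀ s t, M s t = M t s) (hdiag : ∀ s, M s s = 1)
    (hge2 : ∀ s t, s ≠ t → 2 ≤ M s t)
    (htri : ∀ a b c : S, a ≠ b → b ≠ c → a ≠ c →
      TriangleCond (M a b) (M b c) (M a c)) :
    ∀ X : Set S, ∃ ρ : ArtinGroup M →* ArtinGroup M,
      (∀ s ∈ X, ρ (agen M s) = agen M s) ∧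
      (∀ v ∉ X, ∀ a ∈ X, OddLab (M v a) → ρ (agen M v) = agen M a) ∧
      (∀ v ∉ X, (∀ a ∈ X, EvenOrInf (M v a)) → ρ (agen M v) = 1) ∧
      IsRetraction ρ (parabolic M X) := by
  intro X
  have hrel : ∀ r ∈ ArtinRels M, FreeGroup.lift (ordinaryRetractionFun M X) r = 1 := by
    rintro _ ⟨s, t, m, hst, hm, rfl⟩
    rw [map_mul, map_inv, mul_inv_eq_one, map_altProd, map_altProd]
    simpa using altProd_ordinaryRetractionFun hsymm htri hst hm
  have hof (s : S) : PresentedGroup.toGroup hrel (agen M s) = ordinaryRetractionFun M X s :=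
    PresentedGroup.toGroup.of hrel
  have hfix : ∀ s ∈ X, PresentedGroup.toGroup hrel (agen M s) = agen M s := fun s hs =>
    (hof s).trans (ordinaryRetractionFun_eq hsymm htri ⟨hs, .inl rfl⟩)
  refine ⟨PresentedGroup.toGroup hrel, hfix, fun v hv a ha hodd => ?_, fun v hv he => ?_,
    isRetraction_parabolic (fun s => ?_) hfix⟩
  · exact (hof v).trans (ordinaryRetractionFun_eq hsymm htri ⟨ha, .inr ⟨hv, hodd⟩⟩)
  · refine (hof v).trans (ordinaryRetractionFun_of_not_exists ?_)
    rintro ⟨a, ha, rfl | ⟨-, m, hm, hodd⟩⟩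
    · exact hv ha
    · exact Nat.not_even_iff_odd.mpr hodd (he a ha m hm)
  · exact hof s ▸ ordinaryRetractionFun_mem_parabolic M X s
end

section
/- Suppose M s t is even or equal to ∞ for all s ≠ t in S (A_M is an even Artin group). Let X ⊆ S and let ρ_X : A_M → A_M be the retraction onto A_X determined by ρ_X(s) = s for s ∈ X and ρ_X(s) = 1 for s ∉ X. If α, β ∈ A_M satisfy α·A_X·α⁻¹ = β·A_X·β⁻¹, then for every g ∈ A_M one has α·ρ_X(α⁻¹gα)·α⁻¹ = β·ρ_X(β⁻¹gβ)·β⁻¹. -/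
/-- If `ρ` is a retraction of `G` onto `H` and `α H α⁻¹ = β H β⁻¹`, then the retractions onto this
conjugate induced by `ρ` through `α` and through `β` coincide. -/
theorem IsRetraction.conj_eq_of_conjSub_eq {G : Type*} [Group G] {ρ : G →* G} {H : Subgroup G}
    (hρ : IsRetraction ρ H) {α β : G} (hconj : conjSub α H = conjSub β H) (g : G) :
    α * ρ (α⁻¹ * g * α) * α⁻¹ = β * ρ (β⁻¹ * g * β) * β⁻¹ := by
  have hmem : β * ρ (β⁻¹ * g * β) * β⁻¹ ∈ conjSub α H := by
    rw [hconj]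
    exact ⟨_, hρ.1 (β⁻¹ * g * β), rfl⟩
  obtain ⟨z, hz, hzeq⟩ := hmem
  replace hzeq : α * z * α⁻¹ = β * ρ (β⁻¹ * g * β) * β⁻¹ := hzeq
  have hρz : ρ α * z * (ρ α)⁻¹ = ρ g := by
    have := congrArg ρ hzeq
    simp only [map_mul, map_inv, hρ.2 z hz, hρ.2 _ (hρ.1 _)] at this
    rw [this]
    group
  rw [← hzeq, map_mul, map_mul, map_inv, ← hρz]
  group


/-- In an even Artin group, if `ρ` is the retraction onto the standard parabolic
subgroup `A_X` determined by `ρ(s) = s` for `s ∈ X` and `ρ(s) = 1` for `s ∉ X`,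
and `α A_X α⁻¹ = β A_X β⁻¹`, then the associated retractions onto this conjugate
coincide: `α·ρ(α⁻¹gα)·α⁻¹ = β·ρ(β⁻¹gβ)·β⁻¹` for every `g`. -/
theorem even_conjugate_retractions_agree {S : Type*} [Fintype S] (M : S → S → ℕ∞)
    (hsymm : ∀ s t, M s t = M t s) (hdiag : ∀ s, M s s = 1)
    (hge2 : ∀ s t, s ≠ t → 2 ≤ M s t)
    (heven : ∀ s t : S, s ≠ t → EvenOrInf (M s t))
    (X : Set S) (ρ : ArtinGroup M →* ArtinGroup M)
    (hret : IsRetraction ρ (parabolic M X))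
    (hfix : ∀ s ∈ X, ρ (agen M s) = agen M s)
    (hkill : ∀ s ∉ X, ρ (agen M s) = 1)
    (α β : ArtinGroup M)
    (hconj : conjSub α (parabolic M X) = conjSub β (parabolic M X)) :
    ∀ g : ArtinGroup M, α * ρ (α⁻¹ * g * α) * α⁻¹ = β * ρ (β⁻¹ * g * β) * β⁻¹ := by
  exact hret.conj_eq_of_conjSub_eq hconj
end

section
/- Let X ⊆ S and suppose there exists a retraction of A_M onto the standard parabolic subgroup A_X. Then for all g, h ∈ A_M, if g·A_X·g⁻¹ ≤ h·A_X·h⁻¹ then g·A_X·g⁻¹ = h·A_X·h⁻¹. -/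
section Conjugation

variable {G : Type*} [Group G]

theorem mem_conjSub_iff {g x : G} {H : Subgroup G} :
    x ∈ conjSub g H ↔ g⁻¹ * x * g ∈ H := by
  constructor
  · rintro ⟨y, hy, rfl⟩
    simpa [mul_assoc] using hy
  · intro hx
    exact ⟨g⁻¹ * x * g, hx, by simp [mul_assoc]⟩

/-- A retract of a group contains no proper conjugate of itself: conjugation by `a` agrees on `H`
with conjugation by `ρ a ∈ H` as soon as it maps `H` into itself. -/
theorem IsRetraction.inv_mul_mul_mem {ρ : G →* G} {H : Subgroup G} (hρ : IsRetraction ρ H)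
    {a : G} (ha : ∀ x ∈ H, a * x * a⁻¹ ∈ H) {y : G} (hy : y ∈ H) : a⁻¹ * y * a ∈ H := by
  have hx : (ρ a)⁻¹ * y * ρ a ∈ H :=
    H.mul_mem (H.mul_mem (H.inv_mem (hρ.1 a)) hy) (hρ.1 a)
  have key : a * ((ρ a)⁻¹ * y * ρ a) * a⁻¹ = y := by
    rw [← hρ.2 _ (ha _ hx)]
    simp only [map_mul, map_inv, hρ.2 _ (hρ.1 a), hρ.2 y hy]
    group
  have hconj : a⁻¹ * y * a = (ρ a)⁻¹ * y * ρ a := by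
    conv_lhs => rw [← key]
    group
  rwa [hconj]

theorem IsRetraction.conjSub_eq_of_le {ρ : G →* G} {H : Subgroup G} (hρ : IsRetraction ρ H)
    {g h : G} (hle : conjSub g H ≤ conjSub h H) : conjSub g H = conjSub h H := by
  refine le_antisymm hle fun x hx => ?_
  rw [mem_conjSub_iff] at hx ⊢
  have ha : ∀ y ∈ H, h⁻¹ * g * y * (h⁻¹ * g)⁻¹ ∈ H := fun y hy => by
    have hmem := mem_conjSub_iff.1 (hle (mem_conjSub_iff.2
      (show g⁻¹ * (g * y * g⁻¹) * g ∈ H by simpa [mul_assoc] using hy)))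
    simpa [mul_assoc] using hmem
  simpa [mul_assoc] using hρ.inv_mul_mul_mem ha hx

end Conjugation

/-- If the Artin group of `M` admits a retraction onto the standard parabolic
subgroup `A_X`, then containment between conjugates of `A_X` implies equality:
`g A_X g⁻¹ ≤ h A_X h⁻¹` implies `g A_X g⁻¹ = h A_X h⁻¹`. -/
theorem conjugate_parabolic_le_iff_eq {S : Type*} [Fintype S] (M : S → S → ℕ∞)
    (hsymm : ∀ s t, M s t = M t s) (hdiag : ∀ s, M s s = 1)
    (hge2 : ∀ s t, s ≠ t → 2 ≤ M s t)
    (X : Set S) (ρ : ArtinGroup M →* ArtinGroup M)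
    (hρ : IsRetraction ρ (parabolic M X)) :
    ∀ g h : ArtinGroup M,
      conjSub g (parabolic M X) ≤ conjSub h (parabolic M X) →
      conjSub g (parabolic M X) = conjSub h (parabolic M X) := by
  exact fun g h hle => hρ.conjSub_eq_of_le hle
end

section
/- Suppose M is (odd, odd)-free and A_M admits ordinary retractions. Let X, Y ⊆ S and let ρ_X, ρ_Y, ρ_{X∩Y} be the corresponding ordinary retractions. Then for every s ∈ S, either (i) ρ_{X∩Y}(s) = 1, or (ii) ρ_{X∩Y}(s) = ρ_X(ρ_Y(s)) = ρ_Y(ρ_X(s)). Moreover, alternative (ii) always holds except possibly when s ∈ X \ Y and there is a ∈ Y \ X with M s a odd and finite, or s ∈ Y \ X and there is a ∈ X \ Y with M s a odd and finite. -/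
/-- `ρ` is the ordinary retraction of the Artin group of `M` onto the standard
parabolic subgroup over `X`: it is a retraction onto `A_X`, it fixes the generators
in `X`, it sends a generator `v ∉ X` joined to some `a ∈ X` by an odd label to `a`,
and it kills the generators `v ∉ X` all of whose labels towards `X` are even or `∞`. -/
def IsOrdinaryRetraction {S : Type*} (M : S → S → ℕ∞) (X : Set S)
    (ρ : ArtinGroup M →* ArtinGroup M) : Prop :=
  IsRetraction ρ (parabolic M X) ∧
  (∀ s ∈ X, ρ (agen M s) = agen M s) ∧
  (∀ v ∉ X, ∀ a ∈ X, OddLab (M v a) → ρ (agen M v) = agen M a) ∧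
  (∀ v ∉ X, (∀ a ∈ X, EvenOrInf (M v a)) → ρ (agen M v) = 1)

/-- `M` has no two consecutive odd-labelled edges. -/
def OddOddFree {S : Type*} (M : S → S → ℕ∞) : Prop :=
  ¬ ∃ s t u : S, s ≠ t ∧ t ≠ u ∧ s ≠ u ∧ OddLab (M s t) ∧ OddLab (M t u)

/-- `O_{X,Y}`: the elements of `X \ Y` joined to some element of `Y \ X` by an
odd label. -/
def Oset {S : Type*} (M : S → S → ℕ∞) (X Y : Set S) : Set S :=
  {x | x ∈ X \ Y ∧ ∃ y ∈ Y \ X, OddLab (M x y)}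

/-- `C_{X,Y} = (X ∩ Y) ∪ O_{X,Y}`. -/
def Cset {S : Type*} (M : S → S → ℕ∞) (X Y : Set S) : Set S :=
  (X ∩ Y) ∪ Oset M X Y

/-- The link of `s`: the vertices joined to `s` by a finite label. -/
def lkset {S : Type*} (M : S → S → ℕ∞) (s : S) : Set S :=
  {t | t ≠ s ∧ M s t ≠ ⊤}

theorem evenOrInf_of_not_oddLab {x : ℕ∞} (h : ¬ OddLab x) : EvenOrInf x :=
  fun m hm => Nat.not_odd_iff_even.mp fun ho => h ⟨m, hm, ho⟩

/-- An ordinary retraction kills a generator outside `Z` without odd neighbours in `Z`. -/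
theorem IsOrdinaryRetraction.apply_eq_one {S : Type*} {M : S → S → ℕ∞} {Z : Set S}
    {ρ : ArtinGroup M →* ArtinGroup M} (h : IsOrdinaryRetraction M Z ρ) {v : S}
    (hv : v ∉ Z) (hodd : ∀ a ∈ Z, ¬ OddLab (M v a)) : ρ (agen M v) = 1 :=
  h.2.2.2 v hv fun a ha => evenOrInf_of_not_oddLab (hodd a ha)

/-- In an (odd, odd)-free matrix, every vertex has at most one odd neighbour. -/
theorem OddOddFree.eq_of_oddLab {S : Type*} {M : S → S → ℕ∞}
    (hsymm : ∀ s t, M s t = M t s) (hfree : OddOddFree M) {s a b : S}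
    (ha : a ≠ s) (hb : b ≠ s) (hsa : OddLab (M s a)) (hsb : OddLab (M s b)) : b = a := by
  by_contra hne
  exact hfree ⟨b, s, a, hb, ha.symm, hne, hsymm s b ▸ hsb, hsa⟩

/-- An ordinary retraction onto `A_Z` kills a generator `s` if neither `s` nor its odd
neighbour `a` lies in `Z`. -/
theorem IsOrdinaryRetraction.apply_eq_one_of_partner {S : Type*} {M : S → S → ℕ∞}
    (hsymm : ∀ s t, M s t = M t s) (hfree : OddOddFree M) {Z : Set S}
    {ρ : ArtinGroup M →* ArtinGroup M} (h : IsOrdinaryRetraction M Z ρ) {s a : S}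
    (ha : a ≠ s) (hsa : OddLab (M s a)) (hs : s ∉ Z) (haZ : a ∉ Z) : ρ (agen M s) = 1 := by
  refine h.apply_eq_one hs fun b hb hsb => haZ ?_
  have hbs : b ≠ s := fun e => hs (e ▸ hb)
  exact hfree.eq_of_oddLab hsymm ha hbs hsa hsb ▸ hb

/-- In an (odd, odd)-free Artin group admitting ordinary retractions, for subsets
`X, Y ⊆ S` with ordinary retractions `ρX`, `ρY`, `ρXY` onto `A_X`, `A_Y`, `A_{X∩Y}`,
every generator `s` satisfies (i) `ρXY(s) = 1`, or
(ii) `ρXY(s) = ρX(ρY(s)) = ρY(ρX(s))`; moreover (ii) holds always except possibly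
when `s ∈ X \ Y` is joined to `Y \ X` by an odd label, or `s ∈ Y \ X` is joined
to `X \ Y` by an odd label. -/
theorem ordinary_retractions_almost_commute {S : Type*} [Fintype S] (M : S → S → ℕ∞)
    (hsymm : ∀ s t, M s t = M t s) (hdiag : ∀ s, M s s = 1)
    (hge2 : ∀ s t, s ≠ t → 2 ≤ M s t)
    (hfree : OddOddFree M)
    (hord : ∀ Z : Set S, ∃ ρ : ArtinGroup M →* ArtinGroup M,
      IsOrdinaryRetraction M Z ρ)
    (X Y : Set S) (ρX ρY ρXY : ArtinGroup M →* ArtinGroup M)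
    (hX : IsOrdinaryRetraction M X ρX) (hY : IsOrdinaryRetraction M Y ρY)
    (hXY : IsOrdinaryRetraction M (X ∩ Y) ρXY) :
    ∀ s : S,
      (ρXY (agen M s) = 1 ∨
        (ρXY (agen M s) = ρX (ρY (agen M s)) ∧
         ρXY (agen M s) = ρY (ρX (agen M s)))) ∧
      (¬ ((s ∈ X \ Y ∧ ∃ a ∈ Y \ X, OddLab (M s a)) ∨
          (s ∈ Y \ X ∧ ∃ a ∈ X \ Y, OddLab (M s a))) →
        (ρXY (agen M s) = ρX (ρY (agen M s)) ∧
         ρXY (agen M s) = ρY (ρX (agen M s)))) := by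
  intro s
  by_cases hpart : ∃ a, a ≠ s ∧ OddLab (M s a)
  · obtain ⟨a, ha, hsa⟩ := hpart
    have has : OddLab (M a s) := hsymm s a ▸ hsa
    have onto : ∀ {Z : Set S} {ρ : ArtinGroup M →* ArtinGroup M},
        IsOrdinaryRetraction M Z ρ → s ∉ Z → a ∈ Z → ρ (agen M s) = agen M a :=
      fun h hs haZ => h.2.2.1 s hs a haZ hsa
    have kill : ∀ {Z : Set S} {ρ : ArtinGroup M →* ArtinGroup M},
        IsOrdinaryRetraction M Z ρ → s ∉ Z → a ∉ Z →
          ρ (agen M s) = 1 ∧ ρ (agen M a) = 1 := fun h hs haZ =>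
      ⟨h.apply_eq_one_of_partner hsymm hfree ha hsa hs haZ,
        h.apply_eq_one_of_partner hsymm hfree ha.symm has haZ hs⟩
    by_cases hsX : s ∈ X <;> by_cases hsY : s ∈ Y <;>
      by_cases haX : a ∈ X <;> by_cases haY : a ∈ Y <;>
      grind [IsOrdinaryRetraction]
  · push Not at hpart
    have kill : ∀ {Z : Set S} {ρ : ArtinGroup M →* ArtinGroup M},
        IsOrdinaryRetraction M Z ρ → s ∉ Z → ρ (agen M s) = 1 := fun h hs =>
      h.apply_eq_one hs fun b hb => hpart b fun e => hs (e ▸ hb)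
    by_cases hsX : s ∈ X <;> by_cases hsY : s ∈ Y <;>
      grind [IsOrdinaryRetraction]
end

section
/- Suppose M is (odd, odd)-free and A_M admits ordinary retractions. Then for any f, g ∈ A_M and any X, Y ⊆ S, there exist x ∈ A_X and y ∈ A_Y such that f·A_X·f⁻¹ ∩ g·A_Y·g⁻¹ = (fx)·A_{C_{X,Y}}·(fx)⁻¹ ∩ (gy)·A_{C_{Y,X}}·(gy)⁻¹. -/
theorem mem_conjSub {G : Type*} [Group G] {g h : G} {H : Subgroup G} :
    h ∈ conjSub g H ↔ g⁻¹ * h * g ∈ H := by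
  constructor
  · rintro ⟨k, hk, rfl⟩
    simpa [mul_assoc] using hk
  · intro hh
    exact ⟨_, hh, by simp [mul_assoc]⟩

theorem parabolic_mono {S : Type*} (M : S → S → ℕ∞) {X Y : Set S} (hXY : X ⊆ Y) :
    parabolic M X ≤ parabolic M Y :=
  Subgroup.closure_mono (Set.image_mono hXY)

theorem Cset_subset_left {S : Type*} (M : S → S → ℕ∞) (X Y : Set S) : Cset M X Y ⊆ X := by
  rintro s (hs | hs)
  · exact hs.1
  · exact hs.1.1

theorem conjSub_mul_le {G : Type*} [Group G] {f x : G} {H K : Subgroup G} (hx : x ∈ H)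
    (hKH : K ≤ H) : conjSub (f * x) K ≤ conjSub f H := by
  intro h hh
  rw [mem_conjSub] at hh ⊢
  have key := H.mul_mem (H.mul_mem hx (hKH hh)) (H.inv_mem hx)
  simpa [mul_assoc] using key

/-- The ordinary retraction onto `A_X` maps `A_Y` into `A_{C_{X,Y}}`. -/
theorem IsOrdinaryRetraction.map_parabolic_le {S : Type*} {M : S → S → ℕ∞}
    (hsymm : ∀ s t, M s t = M t s) {X : Set S} {ρ : ArtinGroup M →* ArtinGroup M}
    (hρ : IsOrdinaryRetraction M X ρ) (Y : Set S) :
    (parabolic M Y).map ρ ≤ parabolic M (Cset M X Y) := by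
  obtain ⟨-, hfix, hodd, heven⟩ := hρ
  rw [Subgroup.map_le_iff_le_comap, parabolic, Subgroup.closure_le]
  rintro _ ⟨v, hvY, rfl⟩
  change ρ (agen M v) ∈ parabolic M (Cset M X Y)
  by_cases hvX : v ∈ X
  · rw [hfix v hvX]
    exact Subgroup.subset_closure ⟨v, Or.inl ⟨hvX, hvY⟩, rfl⟩
  by_cases hex : ∃ a ∈ X, OddLab (M v a)
  · obtain ⟨a, haX, hva⟩ := hex
    rw [hodd v hvX a haX hva]
    refine Subgroup.subset_closure ⟨a, ?_, rfl⟩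
    by_cases haY : a ∈ Y
    · exact Or.inl ⟨haX, haY⟩
    · exact Or.inr ⟨⟨haX, haY⟩, v, ⟨hvY, hvX⟩, hsymm v a ▸ hva⟩
  · rw [heven v hvX fun a haX m hm => ?_]
    · exact one_mem _
    · by_contra hm'
      exact hex ⟨a, haX, m, hm, Nat.not_even_iff_odd.mp hm'⟩

theorem IsOrdinaryRetraction.conjSub_inf_le {S : Type*} {M : S → S → ℕ∞}
    (hsymm : ∀ s t, M s t = M t s) {X : Set S} {ρ : ArtinGroup M →* ArtinGroup M}
    (hρ : IsOrdinaryRetraction M X ρ) (Y : Set S) (f g : ArtinGroup M) :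
    conjSub f (parabolic M X) ⊓ conjSub g (parabolic M Y) ≤
      conjSub (f * ρ (f⁻¹ * g)) (parabolic M (Cset M X Y)) := by
  intro h hh
  obtain ⟨hf, hg⟩ := Subgroup.mem_inf.mp hh
  rw [mem_conjSub] at hf hg ⊢
  have key := hρ.map_parabolic_le hsymm Y (Subgroup.mem_map_of_mem ρ hg)
  rw [show g⁻¹ * h * g = (f⁻¹ * g)⁻¹ * (f⁻¹ * h * f) * (f⁻¹ * g) by group,
    map_mul, map_mul, map_inv, hρ.1.2 _ hf] at key
  simpa only [mul_inv_rev, mul_assoc] using key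

/-- In an (odd, odd)-free Artin group admitting ordinary retractions, the
intersection of two parabolic subgroups `f A_X f⁻¹ ∩ g A_Y g⁻¹` equals an
intersection of parabolic subgroups over the sets `C_{X,Y}` and `C_{Y,X}`:
there are `x ∈ A_X`, `y ∈ A_Y` with
`f A_X f⁻¹ ∩ g A_Y g⁻¹ = (fx) A_{C_{X,Y}} (fx)⁻¹ ∩ (gy) A_{C_{Y,X}} (gy)⁻¹`. -/
theorem intersection_reduces_to_Csets {S : Type*} [Fintype S] (M : S → S → ℕ∞)
    (hsymm : ∀ s t, M s t = M t s) (hdiag : ∀ s, M s s = 1)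
    (hge2 : ∀ s t, s ≠ t → 2 ≤ M s t)
    (hfree : OddOddFree M)
    (hord : ∀ Z : Set S, ∃ ρ : ArtinGroup M →* ArtinGroup M,
      IsOrdinaryRetraction M Z ρ)
    (f g : ArtinGroup M) (X Y : Set S) :
    ∃ x ∈ parabolic M X, ∃ y ∈ parabolic M Y,
      conjSub f (parabolic M X) ⊓ conjSub g (parabolic M Y) =
        conjSub (f * x) (parabolic M (Cset M X Y)) ⊓
          conjSub (g * y) (parabolic M (Cset M Y X)) := by
  obtain ⟨ρ, hρ⟩ := hord X
  obtain ⟨σ, hσ⟩ := hord Y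
  have hx := hρ.1.1 (f⁻¹ * g)
  have hy := hσ.1.1 (g⁻¹ * f)
  refine ⟨_, hx, _, hy, le_antisymm ?_ ?_⟩
  · refine le_inf (hρ.conjSub_inf_le hsymm Y f g) ?_
    rw [inf_comm]
    exact hσ.conjSub_inf_le hsymm X g f
  · exact inf_le_inf (conjSub_mul_le hx (parabolic_mono M (Cset_subset_left M X Y)))
      (conjSub_mul_le hy (parabolic_mono M (Cset_subset_left M Y X)))
end

section
/- Suppose M is (odd, odd)-free and there are no three pairwise distinct u, v, w ∈ S with M u v odd and finite, M v w even and finite, and M u w = ∞. Let s ∈ S and D ⊆ S with s ∉ D, and suppose D is not contained in lk(s). Then there exists y ∈ D with y ∉ C_{D, lk(s)}; that is, there exists y ∈ D such that M s y = ∞ and there is no y' ∈ lk(s) \ D with M y y' odd and finite. -/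
/-- If `M` is (odd, odd)-free, has no triangle with labels `(odd, even, ∞)`, and
`D` is a set not containing `s` and not contained in `lk(s)`, then some `y ∈ D`
lies outside `C_{D, lk(s)}`; that is, some `y ∈ D` satisfies `M s y = ∞` and is
joined to no element of `lk(s) \ D` by an odd label. -/
theorem exists_elt_outside_C {S : Type*} [Fintype S] (M : S → S → ℕ∞)
    (hsymm : ∀ s t, M s t = M t s) (hdiag : ∀ s, M s s = 1)
    (hge2 : ∀ s t, s ≠ t → 2 ≤ M s t)
    (hfree : OddOddFree M)
    (htri : ¬ ∃ u v w : S, u ≠ v ∧ v ≠ w ∧ u ≠ w ∧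
      OddLab (M u v) ∧ EvenFin (M v w) ∧ M u w = ⊤)
    (s : S) (D : Set S) (hsD : s ∉ D) (hD : ¬ D ⊆ lkset M s) :
    ∃ y ∈ D, y ∉ Cset M D (lkset M s) ∧ M s y = ⊤ ∧
      ∀ y' ∈ lkset M s \ D, ¬ OddLab (M y y') := by
  obtain ⟨y, hyD, hylk⟩ := Set.not_subset.mp hD
  have hys : y ≠ s := fun h => hsD (h ▸ hyD)
  have htop : M s y = ⊤ := by
    by_contra h
    exact hylk ⟨hys, h⟩
  have hodd : ∀ y' ∈ lkset M s \ D, ¬ OddLab (M y y') := by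
    rintro y' ⟨⟨hy's, hfin⟩, hy'D⟩ hyy'
    have hne : y ≠ y' := fun h => hy'D (h ▸ hyD)
    obtain ⟨m, hm⟩ := ENat.ne_top_iff_exists.mp hfin
    have hm' : M y' s = (m : ℕ∞) := by rw [hsymm, hm]
    rcases Nat.even_or_odd m with he | ho
    · exact htri ⟨y, y', s, hne, hy's, hys, hyy', ⟨m, hm', he⟩, by rw [hsymm, htop]⟩
    · exact hfree ⟨y, y', s, hne, hy's, hys, hyy', ⟨m, hm', ho⟩⟩
  refine ⟨y, hyD, ?_, htop, hodd⟩
  rintro (h | ⟨-, y', hy', ho⟩)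
  · exact hylk h.2
  · exact hodd y' hy' ho
end
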